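/- Suppose V̂ satisfies the Bellman equation for π. Then for every action a, the conditional variance of the δHCA estimator is at most that of the Monte-Carlo estimator: Var_π(Â^δHCA_N(a) | S_0 = s) ≤ Var_π(Â^MC_N(a) | S_0 = s). -/

import Mathlib

open Finset

attribute [local instance] Classical.propDecidable

namespace HCA

/-- A trajectory of horizon `N`: the actions taken at steps `0, …, N-1` and the
states reached after each step (the start state is fixed separately). -/
abbrev Traj (S A : Type*) (N : ℕ) : Type _ := (Fin N → A) × (Fin N → S)

variable {S A : Type*} [Fintype S] [Fintype A] [Nonempty S] [Nonempty A]

/-- The state `S_k` of a trajectory with start state `s`. -/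
def st {N : ℕ} (s : S) (τ : Traj S A N) : ℕ → S
  | 0 => s
  | k + 1 => if h : k < N then τ.2 ⟨k, h⟩ else s

/-- The action `A_k` of a trajectory. -/
noncomputable def ac {N : ℕ} (τ : Traj S A N) (k : ℕ) : A :=
  if h : k < N then τ.1 ⟨k, h⟩ else Classical.arbitrary A

/-- The probability `P_π(τ) = ∏_{k=0}^{N-1} π(A_k|S_k)·P(S_{k+1}|S_k,A_k)` of a
trajectory starting at `s`. -/
noncomputable def trajP (π : S → A → ℝ) (P : S → A → S → ℝ) (s : S) (N : ℕ)
    (τ : Traj S A N) : ℝ :=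
  ∏ k : Fin N, π (st s τ k) (τ.1 k) * P (st s τ k) (τ.1 k) (st s τ (k + 1))

/-- Expectation `E_π[f | S_0 = s]` over trajectories. -/
noncomputable def expct (π : S → A → ℝ) (P : S → A → S → ℝ) (s : S) (N : ℕ)
    (f : Traj S A N → ℝ) : ℝ :=
  ∑ τ : Traj S A N, trajP π P s N τ * f τ

/-- Variance `Var_π(f | S_0 = s)` over trajectories. -/
noncomputable def vr (π : S → A → ℝ) (P : S → A → S → ℝ) (s : S) (N : ℕ)
    (f : Traj S A N → ℝ) : ℝ :=
  expct π P s N (fun τ => (f τ - expct π P s N f) ^ 2)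

/-- Covariance `cov_π(f, g | S_0 = s)` over trajectories. -/
noncomputable def cv (π : S → A → ℝ) (P : S → A → S → ℝ) (s : S) (N : ℕ)
    (f g : Traj S A N → ℝ) : ℝ :=
  expct π P s N (fun τ => (f τ - expct π P s N f) * (g τ - expct π P s N g))

/-- Probability `P_π(E | S_0 = s)` of an event `E` on trajectories. -/
noncomputable def prE (π : S → A → ℝ) (P : S → A → S → ℝ) (s : S) (N : ℕ)
    (E : Traj S A N → Prop) : ℝ :=
  ∑ τ : Traj S A N, if E τ then trajP π P s N τ else 0

/-- The TD error `δ_k = r(S_k,A_k) + γ·V̂(S_{k+1}) − V̂(S_k)`. -/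
noncomputable def td (r : S → A → ℝ) (γ : ℝ) (V : S → ℝ) (s : S) {N : ℕ}
    (τ : Traj S A N) (k : ℕ) : ℝ :=
  r (st s τ k) (ac τ k) + γ * V (st s τ (k + 1)) - V (st s τ k)

/-- `p_k(s'|s,a) = P_π(S_k = s' | S_0 = s, A_0 = a)
  = P_π(A_0 = a, S_k = s' | S_0 = s) / π(a|s)`. -/
noncomputable def pkSA (π : S → A → ℝ) (P : S → A → S → ℝ) (s : S) (N k : ℕ)
    (a : A) (s' : S) : ℝ :=
  prE π P s N (fun τ => ac τ 0 = a ∧ st s τ k = s') / π s a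

/-- `p_k(s'|s) = Σ_a π(a|s)·p_k(s'|s,a)`. -/
noncomputable def pkS (π : S → A → ℝ) (P : S → A → S → ℝ) (s : S) (N k : ℕ)
    (s' : S) : ℝ :=
  ∑ a : A, π s a * pkSA π P s N k a s'

/-- The hindsight probability `p_k(a|s,s')`, defined as
`P_π(A_0 = a, S_k = s' | S_0 = s)/p_k(s'|s)` when `p_k(s'|s) > 0` and `0` otherwise. -/
noncomputable def pkA (π : S → A → ℝ) (P : S → A → S → ℝ) (s : S) (N k : ℕ)
    (a : A) (s' : S) : ℝ :=
  if 0 < pkS π P s N k s' then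
    prE π P s N (fun τ => ac τ 0 = a ∧ st s τ k = s') / pkS π P s N k s'
  else 0

/-- The `N`-step Monte-Carlo advantage estimator
`Â^MC_N(a) = (1(A_0=a)/π(a|s))·Σ_{k=0}^{N−1} γ^k·δ_k`. -/
noncomputable def mcEst (π : S → A → ℝ) (r : S → A → ℝ) (γ : ℝ) (V : S → ℝ)
    (s : S) (N : ℕ) (a : A) (τ : Traj S A N) : ℝ :=
  ((if ac τ 0 = a then (1 : ℝ) else 0) / π s a) * ∑ k ∈ range N, γ ^ k * td r γ V s τ k

/-- The `N`-step δHCA advantage estimator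
`Â^δHCA_N(a) = (1(A_0=a)/π(a|s))·δ_0 + Σ_{k=1}^{N−1} γ^k·(p_k(a|s,S_k)/π(a|s))·δ_k`. -/
noncomputable def dhcaEst (π : S → A → ℝ) (P : S → A → S → ℝ) (r : S → A → ℝ)
    (γ : ℝ) (V : S → ℝ) (s : S) (N : ℕ) (a : A) (τ : Traj S A N) : ℝ :=
  ((if ac τ 0 = a then (1 : ℝ) else 0) / π s a) * td r γ V s τ 0
    + ∑ k ∈ Ico 1 N, γ ^ k * (pkA π P s N k a (st s τ k) / π s a) * td r γ V s τ k

/-- `V` satisfies the Bellman equation for `π`: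
`V(s₀) = Σ_a π(a|s₀)·(r(s₀,a) + γ·Σ_{s'} P(s'|s₀,a)·V(s'))` for every state `s₀`. -/
def IsBellman (π : S → A → ℝ) (P : S → A → S → ℝ) (r : S → A → ℝ) (γ : ℝ)
    (V : S → ℝ) : Prop :=
  ∀ s₀ : S, V s₀ = ∑ a : A, π s₀ a * (r s₀ a + γ * ∑ s' : S, P s₀ a s' * V s')

/-- The conditional second moment `E_π[δ_k² | S_0 = s, S_k = s']`,
defined as `(Σ_{τ : S_k = s'} P_π(τ)·δ_k(τ)²)/p_k(s'|s)`. -/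
noncomputable def sndMom (π : S → A → ℝ) (P : S → A → S → ℝ) (r : S → A → ℝ)
    (γ : ℝ) (V : S → ℝ) (s : S) (N k : ℕ) (s' : S) : ℝ :=
  (∑ τ : Traj S A N, if st s τ k = s' then trajP π P s N τ * (td r γ V s τ k) ^ 2 else 0)
    / pkS π P s N k s'

def consT {N : ℕ} (a : A) (s' : S) (τ : Traj S A N) : Traj S A (N + 1) :=
  (Fin.cons a τ.1, Fin.cons s' τ.2)

theorem st_consT {N : ℕ} (s s' : S) (a : A) (τ : Traj S A N) (k : ℕ) (hk : k ≤ N) :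
    st s (consT a s' τ) (k + 1) = st s' τ k := by
  cases k with
  | zero => simp [st, consT]
  | succ k =>
    have h : k < N := hk
    have e : (⟨k + 1, by omega⟩ : Fin (N + 1)) = Fin.succ ⟨k, h⟩ := rfl
    simp only [st, consT, h, dif_pos, Nat.add_lt_add_iff_right, e, Fin.cons_succ]

theorem ac_consT_zero {N : ℕ} (s' : S) (a : A) (τ : Traj S A N) :
    ac (consT a s' τ) 0 = a := by
  simp [ac, consT]

theorem ac_consT {N : ℕ} (s' : S) (a : A) (τ : Traj S A N) (k : ℕ) (hk : k < N) :
    ac (consT a s' τ) (k + 1) = ac τ k := by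
  have e : (⟨k + 1, by omega⟩ : Fin (N + 1)) = Fin.succ ⟨k, hk⟩ := rfl
  simp only [ac, consT, hk, dif_pos, Nat.add_lt_add_iff_right, e, Fin.cons_succ]

theorem trajP_consT (π : S → A → ℝ) (P : S → A → S → ℝ) (s s' : S) (a : A) (N : ℕ)
    (τ : Traj S A N) :
    trajP π P s (N + 1) (consT a s' τ) = π s a * P s a s' * trajP π P s' N τ := by
  unfold trajP
  rw [Fin.prod_univ_succ]
  congr 1
  refine Finset.prod_congr rfl fun k _ => ?_
  have h1 := st_consT s s' a τ k (by omega)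
  have h2 := st_consT s s' a τ (k + 1) (by omega)
  rw [Fin.val_succ, h1, h2]
  simp [consT]

theorem expct_succ (π : S → A → ℝ) (P : S → A → S → ℝ) (s : S) (N : ℕ)
    (f : Traj S A (N + 1) → ℝ) :
    expct π P s (N + 1) f =
      ∑ a, ∑ s', π s a * P s a s' * expct π P s' N (fun τ => f (consT a s' τ)) := by
  unfold expct
  rw [← ((Equiv.prodProdProdComm A S (Fin N → A) (Fin N → S)).trans
      (Equiv.prodCongr (Fin.consEquiv (fun _ => A)) (Fin.consEquiv (fun _ => S)))).sum_comp,
      Fintype.sum_prod_type, Fintype.sum_prod_type]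
  refine Finset.sum_congr rfl fun a _ => Finset.sum_congr rfl fun s' _ => ?_
  rw [Finset.mul_sum]
  refine Finset.sum_congr rfl fun τ _ => ?_
  rw [← mul_assoc, ← trajP_consT]
  rfl

theorem expct_one (π : S → A → ℝ) (P : S → A → S → ℝ)
    (hπsum : ∀ s₀ : S, ∑ a : A, π s₀ a = 1)
    (hPsum : ∀ (s₀ : S) (a : A), ∑ s' : S, P s₀ a s' = 1) (N : ℕ) :
    ∀ s, expct π P s N (fun _ => 1) = 1 := by
  induction N with
  | zero => intro s; simp [expct, trajP]
  | succ N ih =>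
    intro s
    rw [expct_succ]
    simp only [ih, mul_one, ← Finset.mul_sum, hPsum, hπsum]

theorem expct_const_mul (π : S → A → ℝ) (P : S → A → S → ℝ) (s : S) (N : ℕ) (c : ℝ)
    (f : Traj S A N → ℝ) :
    expct π P s N (fun τ => c * f τ) = c * expct π P s N f := by
  unfold expct
  rw [Finset.mul_sum]
  exact Finset.sum_congr rfl fun τ _ => by ring

theorem expct_sum (π : S → A → ℝ) (P : S → A → S → ℝ) (s : S) (N : ℕ) {ι : Type*}
    (t : Finset ι) (f : ι → Traj S A N → ℝ) :
    expct π P s N (fun τ => ∑ i ∈ t, f i τ) = ∑ i ∈ t, expct π P s N (f i) := by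
  unfold expct
  rw [Finset.sum_comm]
  exact Finset.sum_congr rfl fun τ _ => by rw [Finset.mul_sum]

theorem vr_eq (π : S → A → ℝ) (P : S → A → S → ℝ)
    (hπsum : ∀ s₀ : S, ∑ a : A, π s₀ a = 1)
    (hPsum : ∀ (s₀ : S) (a : A), ∑ s' : S, P s₀ a s' = 1) (s : S) (N : ℕ)
    (f : Traj S A N → ℝ) :
    vr π P s N f = expct π P s N (fun τ => f τ ^ 2) - (expct π P s N f) ^ 2 := by
  have h1 := expct_one π P hπsum hPsum N s
  unfold vr
  set m := expct π P s N f with hm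
  have : expct π P s N (fun τ => (f τ - m) ^ 2)
      = expct π P s N (fun τ => f τ ^ 2) - 2 * m * expct π P s N f
        + m ^ 2 * expct π P s N (fun _ => 1) := by
    unfold expct
    rw [Finset.mul_sum, Finset.mul_sum, ← Finset.sum_sub_distrib, ← Finset.sum_add_distrib]
    exact Finset.sum_congr rfl fun τ _ => by ring
  rw [this, h1, ← hm]; ring

/-- `h` depends only on the first `k` steps. -/
def Dep {N : ℕ} (k : ℕ) (h : Traj S A N → ℝ) : Prop :=
  ∀ τ τ' : Traj S A N, (∀ i : Fin N, (i : ℕ) < k → τ.1 i = τ'.1 i ∧ τ.2 i = τ'.2 i) → h τ = h τ'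

theorem key (π : S → A → ℝ) (P : S → A → S → ℝ)
    (hπsum : ∀ s₀ : S, ∑ a : A, π s₀ a = 1)
    (hPsum : ∀ (s₀ : S) (a : A), ∑ s' : S, P s₀ a s' = 1)
    (f : S → A → S → ℝ) (k : ℕ) :
    ∀ (N : ℕ) (_ : k < N) (s : S) (h : Traj S A N → ℝ) (_ : Dep k h),
      expct π P s N (fun τ => h τ * f (st s τ k) (ac τ k) (st s τ (k + 1)))
        = expct π P s N (fun τ => h τ *
            ∑ a, ∑ s', π (st s τ k) a * P (st s τ k) a s' * f (st s τ k) a s') := by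
  induction k with
  | zero =>
    intro N hN s h hh
    obtain ⟨M, rfl⟩ : ∃ M, N = M + 1 := ⟨N - 1, by omega⟩
    obtain ⟨τ0⟩ : Nonempty (Traj S A (M + 1)) := inferInstance
    have hc : ∀ τ, h τ = h τ0 := fun τ => hh _ _ fun i hi => absurd hi (by omega)
    have e1 : ∀ s, expct π P s M (fun _ => 1) = 1 := expct_one π P hπsum hPsum M
    have e2 : ∀ s c, expct π P s M (fun _ => c) = c := fun s c => by
      have := expct_const_mul π P s M c (fun _ => 1)
      simpa [e1] using this
    rw [expct_succ, expct_succ]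
    simp only [hc, ac_consT_zero, st_consT _ _ _ _ 0 (Nat.zero_le _)]
    simp only [st, e2, ← Finset.sum_mul, ← Finset.mul_sum, hPsum, hπsum, mul_one, one_mul]
    simp only [Finset.mul_sum]
    exact Finset.sum_congr rfl fun a _ => Finset.sum_congr rfl fun s' _ => by ring
  | succ k ih =>
    intro N hN s h hh
    obtain ⟨M, rfl⟩ : ∃ M, N = M + 1 := ⟨N - 1, by omega⟩
    rw [expct_succ, expct_succ]
    refine Finset.sum_congr rfl fun a _ => Finset.sum_congr rfl fun s' _ => ?_
    congr 1
    simp only [st_consT _ _ _ _ k (show k ≤ M by omega), ac_consT _ _ _ k (show k < M by omega),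
      st_consT _ _ _ _ (k + 1) (show k + 1 ≤ M by omega)]
    refine ih M (by omega) s' (fun τ => h (consT a s' τ)) fun τ τ' hτ => hh _ _ fun i hi => ?_
    refine Fin.cases ?_ (fun j => ?_) i (motive := fun i => (i : ℕ) < k + 1 →
      (consT a s' τ).1 i = (consT a s' τ').1 i ∧ (consT a s' τ).2 i = (consT a s' τ').2 i) hi
    · intro _; simp [consT]
    · intro hj
      have := hτ j (by simpa using hj)
      simpa [consT] using this

theorem dep_st {N : ℕ} {τ τ' : Traj S A N} {k j : ℕ} (s : S)
    (h : ∀ i : Fin N, (i : ℕ) < k → τ.1 i = τ'.1 i ∧ τ.2 i = τ'.2 i) (hj : j ≤ k) :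
    st s τ j = st s τ' j := by
  cases j with
  | zero => rfl
  | succ j =>
    simp only [st]
    split_ifs with hh
    · exact (h ⟨j, hh⟩ hj).2
    · rfl

theorem dep_ac {N : ℕ} {τ τ' : Traj S A N} {k j : ℕ}
    (h : ∀ i : Fin N, (i : ℕ) < k → τ.1 i = τ'.1 i ∧ τ.2 i = τ'.2 i) (hj : j < k) :
    ac τ j = ac τ' j := by
  simp only [ac]
  split_ifs with hh
  · exact (h ⟨j, hh⟩ hj).1
  · rfl

theorem dep_td {N : ℕ} {τ τ' : Traj S A N} {k j : ℕ} (r : S → A → ℝ) (γ : ℝ) (V : S → ℝ) (s : S)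
    (h : ∀ i : Fin N, (i : ℕ) < k → τ.1 i = τ'.1 i ∧ τ.2 i = τ'.2 i) (hj : j < k) :
    td r γ V s τ j = td r γ V s τ' j := by
  simp only [td, dep_ac h hj, dep_st s h hj.le, dep_st s h (show j + 1 ≤ k from hj)]

theorem expct_td (π : S → A → ℝ) (P : S → A → S → ℝ) (r : S → A → ℝ) (γ : ℝ)
    (hπsum : ∀ s₀ : S, ∑ a : A, π s₀ a = 1)
    (hPsum : ∀ (s₀ : S) (a : A), ∑ s' : S, P s₀ a s' = 1)
    (V : S → ℝ) (hV : IsBellman π P r γ V) (N k : ℕ) (hk : k < N) (s : S)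
    (h : Traj S A N → ℝ) (hh : Dep k h) :
    expct π P s N (fun τ => h τ * td r γ V s τ k) = 0 := by
  have := key π P hπsum hPsum (fun x a y => r x a + γ * V y - V x) k N hk s h hh
  have z : ∀ x : S, ∑ a, ∑ s', π x a * P x a s' * (r x a + γ * V s' - V x) = 0 := by
    intro x
    have e : ∀ a, ∑ s', π x a * P x a s' * (r x a + γ * V s' - V x)
        = π x a * (r x a + γ * ∑ s', P x a s' * V s') - π x a * V x := by
      intro a
      have : ∀ s', π x a * P x a s' * (r x a + γ * V s' - V x)
        = P x a s' * (π x a * (r x a - V x)) + π x a * γ * (P x a s' * V s') := fun s' => by ring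
      simp only [this, Finset.sum_add_distrib, ← Finset.sum_mul, ← Finset.mul_sum, hPsum]
      ring
    simp only [e, Finset.sum_sub_distrib, ← Finset.sum_mul, hπsum]
    rw [← hV x]; ring
  simp only [z] at this
  unfold td
  rw [this]
  simp [expct]

theorem moments (π : S → A → ℝ) (P : S → A → S → ℝ) (r : S → A → ℝ) (γ : ℝ)
    (hπsum : ∀ s₀ : S, ∑ a : A, π s₀ a = 1)
    (hPsum : ∀ (s₀ : S) (a : A), ∑ s' : S, P s₀ a s' = 1)
    (V : S → ℝ) (hV : IsBellman π P r γ V) (N : ℕ) (hN : 1 ≤ N) (s : S)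
    (w : ℕ → Traj S A N → ℝ) (hw : ∀ k, Dep (max k 1) (w k)) :
    expct π P s N (fun τ => ∑ k ∈ range N, w k τ * td r γ V s τ k)
        = expct π P s N (fun τ => w 0 τ * td r γ V s τ 0) ∧
    expct π P s N (fun τ => (∑ k ∈ range N, w k τ * td r γ V s τ k) ^ 2)
        = ∑ k ∈ range N, expct π P s N (fun τ => w k τ ^ 2 * td r γ V s τ k ^ 2) := by
  constructor
  · rw [expct_sum]
    refine Finset.sum_eq_single_of_mem 0 (Finset.mem_range.2 (by omega)) fun k hk h0 => ?_
    refine expct_td π P r γ hπsum hPsum V hV N k (by simpa using hk) s _ ?_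
    have := hw k
    rwa [max_eq_left (by omega)] at this
  · have cross : ∀ j k, j < k → k < N → expct π P s N (fun τ =>
        (w j τ * td r γ V s τ j) * (w k τ * td r γ V s τ k)) = 0 := by
      intro j k hjk hk
      have := expct_td π P r γ hπsum hPsum V hV N k hk s
        (fun τ => w j τ * td r γ V s τ j * w k τ) (by
          intro τ τ' h
          have h1 : w j τ = w j τ' := hw j τ τ' fun i hi => h i (lt_of_lt_of_le hi (by omega))
          have h2 : w k τ = w k τ' := hw k τ τ' fun i hi => h i (lt_of_lt_of_le hi (by omega))
          simp only [h1, h2, dep_td r γ V s h hjk])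
      rw [← this]
      congr 1
      funext τ; ring
    simp only [sq (∑ k ∈ range N, _), Finset.sum_mul_sum]
    rw [expct_sum]
    refine Finset.sum_congr rfl fun j hj => ?_
    rw [expct_sum, Finset.sum_eq_single_of_mem j hj]
    · congr 1
      funext τ; ring
    · intro k hk hne
      rcases lt_or_gt_of_ne hne with h | h
      · rw [← cross k j h (by simpa using hj)]
        congr 1
        funext τ; ring
      · exact cross j k h (by simpa using hk)

theorem trajP_nonneg (π : S → A → ℝ) (P : S → A → S → ℝ)
    (hπpos : ∀ s₀ a, 0 < π s₀ a) (hPnn : ∀ s₀ a s', 0 ≤ P s₀ a s') (s : S) (N : ℕ)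
    (τ : Traj S A N) : 0 ≤ trajP π P s N τ :=
  Finset.prod_nonneg fun _ _ => mul_nonneg (hπpos _ _).le (hPnn _ _ _)

theorem pkS_eq (π : S → A → ℝ) (P : S → A → S → ℝ)
    (hπpos : ∀ s₀ a, 0 < π s₀ a) (s : S) (N k : ℕ) (s' : S) :
    pkS π P s N k s' = prE π P s N (fun τ => st s τ k = s') := by
  unfold pkS pkSA
  have : ∀ a, π s a * (prE π P s N (fun τ => ac τ 0 = a ∧ st s τ k = s') / π s a)
      = prE π P s N (fun τ => ac τ 0 = a ∧ st s τ k = s') :=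
    fun a => mul_div_cancel₀ _ (hπpos s a).ne'
  simp only [this]
  unfold prE
  rw [Finset.sum_comm]
  refine Finset.sum_congr rfl fun τ _ => ?_
  by_cases h : st s τ k = s' <;> simp [h]

theorem joint_le (π : S → A → ℝ) (P : S → A → S → ℝ)
    (hπpos : ∀ s₀ a, 0 < π s₀ a) (hPnn : ∀ s₀ a s', 0 ≤ P s₀ a s') (s : S) (N k : ℕ)
    (a : A) (s' : S) :
    0 ≤ prE π P s N (fun τ => ac τ 0 = a ∧ st s τ k = s') ∧
    prE π P s N (fun τ => ac τ 0 = a ∧ st s τ k = s') ≤ prE π P s N (fun τ => st s τ k = s') := by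
  have hp := trajP_nonneg π P hπpos hPnn s N
  constructor
  · refine Finset.sum_nonneg fun τ _ => ?_
    split_ifs
    · exact hp τ
    · exact le_rfl
  · refine Finset.sum_le_sum fun τ _ => ?_
    by_cases h1 : ac τ 0 = a <;> by_cases h2 : st s τ k = s' <;> simp [h1, h2, hp τ]

theorem expct_event (π : S → A → ℝ) (P : S → A → S → ℝ) (s : S) (N k : ℕ)
    (E : Traj S A N → Prop) (g : S → ℝ) :
    expct π P s N (fun τ => (if E τ then (1 : ℝ) else 0) * g (st s τ k))
      = ∑ s', prE π P s N (fun τ => E τ ∧ st s τ k = s') * g s' := by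
  unfold expct prE
  simp only [Finset.sum_mul]
  rw [Finset.sum_comm]
  refine Finset.sum_congr rfl fun τ _ => ?_
  by_cases h : E τ <;> simp [h]

theorem weight_le (π : S → A → ℝ) (P : S → A → S → ℝ) (r : S → A → ℝ) (γ : ℝ)
    (hπpos : ∀ s₀ a, 0 < π s₀ a)
    (hπsum : ∀ s₀ : S, ∑ a : A, π s₀ a = 1) (hPnn : ∀ s₀ a s', 0 ≤ P s₀ a s')
    (hPsum : ∀ (s₀ : S) (a : A), ∑ s' : S, P s₀ a s' = 1)
    (V : S → ℝ) (N k : ℕ) (hk : k < N) (hk1 : 1 ≤ k) (s : S) (a : A) :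
    expct π P s N (fun τ => pkA π P s N k a (st s τ k) ^ 2 * td r γ V s τ k ^ 2)
      ≤ expct π P s N (fun τ => (if ac τ 0 = a then (1 : ℝ) else 0) * td r γ V s τ k ^ 2) := by
  have K := key π P hπsum hPsum (fun x a y => (r x a + γ * V y - V x) ^ 2) k N hk s
  have K1 := K (fun τ => pkA π P s N k a (st s τ k) ^ 2) (by
    intro τ τ' h
    simp only [dep_st s h le_rfl])
  have K2 := K (fun τ => if ac τ 0 = a then (1 : ℝ) else 0) (by
    intro τ τ' h
    simp only [dep_ac h hk1])
  unfold td
  rw [K1, K2]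
  have G : ∀ x : S, 0 ≤ ∑ a, ∑ s', π x a * P x a s' * (r x a + γ * V s' - V x) ^ 2 := fun x =>
    Finset.sum_nonneg fun a _ => Finset.sum_nonneg fun s' _ =>
      mul_nonneg (mul_nonneg (hπpos _ _).le (hPnn _ _ _)) (sq_nonneg _)
  generalize hg : (fun x : S => ∑ a, ∑ s', π x a * P x a s' * (r x a + γ * V s' - V x) ^ 2) = g
  have hg' : ∀ x : S, ∑ a, ∑ s', π x a * P x a s' * (r x a + γ * V s' - V x) ^ 2 = g x :=
    fun x => congrFun hg x
  simp only [hg'] at G ⊢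
  rw [expct_event π P s N k (fun τ => ac τ 0 = a) g]
  have E1 := expct_event π P s N k (fun _ => True) (fun x => pkA π P s N k a x ^ 2 * g x)
  simp only [if_true, one_mul, true_and] at E1
  rw [E1]
  refine Finset.sum_le_sum fun x _ => ?_
  rw [← mul_assoc]
  refine mul_le_mul_of_nonneg_right ?_ (G x)
  obtain ⟨j0, j1⟩ := joint_le π P hπpos hPnn s N k a x
  unfold pkA
  rw [pkS_eq π P hπpos]
  split_ifs with hq
  · rw [div_pow, mul_div_assoc', div_le_iff₀ (by positivity)]
    nlinarith [mul_nonneg (mul_nonneg j0 hq.le) (sub_nonneg.2 j1)]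
  · simpa using j0

theorem stmt_3 {S A : Type*} [Fintype S] [Fintype A] [Nonempty S] [Nonempty A]
    (π : S → A → ℝ) (P : S → A → S → ℝ) (r : S → A → ℝ) (γ : ℝ)
    (N : ℕ) (s : S)
    (hπpos : ∀ s₀ a, 0 < π s₀ a) (hπsum : ∀ s₀ : S, ∑ a : A, π s₀ a = 1)
    (hPnn : ∀ s₀ a s', 0 ≤ P s₀ a s') (hPsum : ∀ (s₀ : S) (a : A), ∑ s' : S, P s₀ a s' = 1)
    (hγ0 : 0 ≤ γ) (hγ1 : γ ≤ 1) (hN : 1 ≤ N)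
    (V : S → ℝ) (hV : IsBellman π P r γ V) :
    ∀ a : A, vr π P s N (dhcaEst π P r γ V s N a) ≤ vr π P s N (mcEst π r γ V s N a) := by
  intro a
  have M := moments π P r γ hπsum hPsum V hV N hN s
  let c : Traj S A N → ℝ := fun τ => (if ac τ 0 = a then (1 : ℝ) else 0) / π s a
  let w1 : ℕ → Traj S A N → ℝ := fun k τ => γ ^ k * c τ
  let w2 : ℕ → Traj S A N → ℝ := fun k τ =>
    if k = 0 then c τ else γ ^ k * (pkA π P s N k a (st s τ k) / π s a)
  have hc : ∀ k, Dep (max k 1) c := by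
    intro k τ τ' h
    simp only [c, dep_ac h (show 0 < max k 1 by omega)]
  have M1 := M w1 (by
    intro k τ τ' h
    simp only [w1, hc k τ τ' h])
  have M2 := M w2 (by
    intro k τ τ' h
    simp only [w2, hc k τ τ' h, dep_st s h (le_max_left k 1)])
  have hmc : mcEst π r γ V s N a = fun τ => ∑ k ∈ range N, w1 k τ * td r γ V s τ k := by
    funext τ
    simp only [mcEst, w1, c, Finset.mul_sum]
    exact Finset.sum_congr rfl fun k _ => by ring
  have hdh : dhcaEst π P r γ V s N a = fun τ => ∑ k ∈ range N, w2 k τ * td r γ V s τ k := by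
    funext τ
    rw [Finset.range_eq_Ico, Finset.sum_eq_sum_Ico_succ_bot (by omega)]
    simp only [dhcaEst, w2, c, if_true]
    congr 1
    refine Finset.sum_congr rfl fun k hk => ?_
    have : k ≠ 0 := by have := (Finset.mem_Ico.1 hk).1; omega
    rw [if_neg this]
  have h0 : w1 0 = w2 0 := by funext τ; simp [w1, w2]
  rw [vr_eq π P hπsum hPsum, vr_eq π P hπsum hPsum, hmc, hdh, M1.1, M2.1, M1.2, M2.2, h0]
  refine sub_le_sub_right (Finset.sum_le_sum fun k hk => ?_) _
  by_cases hk0 : k = 0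
  · subst hk0; rw [h0]
  have L := weight_le π P r γ hπpos hπsum hPnn hPsum V N k (by simpa using hk) (by omega) s a
  have L' := mul_le_mul_of_nonneg_left L (sq_nonneg (γ ^ k / π s a))
  rw [← expct_const_mul, ← expct_const_mul] at L'
  convert L' using 2
  · funext τ
    simp only [w2, if_neg hk0]
    ring
  · funext τ
    simp only [w1, c]
    split_ifs <;> ring

end HCA
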